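/- Let G be a quasiprimitive, transitive, imprimitive permutation group of rank 3 on a finite set Ω. Then G is almost simple (G has a unique minimal normal subgroup and this subgroup is nonabelian simple), and G acts faithfully and 2-transitively on its unique nontrivial system of imprimitivity. -/

import Mathlib

/-- A `G`-invariant partition of `Ω` (a system of imprimitivity, possibly trivial). -/
def IsBlockSystem {Ω : Type*} (G : Subgroup (Equiv.Perm Ω)) (P : Set (Set Ω)) : Prop :=
  Setoid.IsPartition P ∧ ∀ g ∈ G, ∀ S ∈ P, (⇑g '' S) ∈ P

/-- A partition is nontrivial if it is neither the partition into singletons nor `{Ω}`. -/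
def IsNontrivialSystem {Ω : Type*} (P : Set (Set Ω)) : Prop :=
  (∃ S ∈ P, ¬ S.Subsingleton) ∧ (∃ S ∈ P, S ≠ Set.univ)

/-- `N` is a minimal normal subgroup of `G`. -/
def IsMinimalNormal {G : Type*} [Group G] (N : Subgroup G) : Prop :=
  N.Normal ∧ N ≠ ⊥ ∧ ∀ M : Subgroup G, M.Normal → M ≠ ⊥ → M ≤ N → M = N

section Burnside

variable {G : Type*} [Group G]

/-- A nonabelian minimal normal subgroup which is not simple is a product of two nontrivial
commuting normal factors `T` and `C`, such that `T` has trivial centre and every conjugate of an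
element of `T` lies in one of the factors. -/
theorem IsMinimalNormal.isSimpleGroup_or_exists_factors [Finite G] {N : Subgroup G}
    (hN : IsMinimalNormal N) (hna : ¬ ∀ x ∈ N, ∀ y ∈ N, x * y = y * x) :
    IsSimpleGroup N ∨ ∃ T C : Subgroup G, T ≠ ⊥ ∧ C ≠ ⊥ ∧ T ≤ N ∧ C ≤ N ∧
      (∀ n ∈ N, ∀ t ∈ T, n * t * n⁻¹ ∈ T) ∧ (∀ n ∈ N, ∀ c ∈ C, n * c * n⁻¹ ∈ C) ∧
      (∀ t ∈ T, ∀ c ∈ C, t * c = c * t) ∧ (∀ n ∈ N, ∃ t ∈ T, ∃ c ∈ C, n = t * c) ∧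
      (∀ t ∈ T, (∀ s ∈ T, s * t = t * s) → t = 1) ∧
      (∀ g : G, ∀ t ∈ T, g * t * g⁻¹ ∈ T ∨ g * t * g⁻¹ ∈ C) := by
  obtain ⟨hnorm, hbot, hmin⟩ := hN
  rw [or_iff_not_imp_left]
  intro hns
  have hH : ∃ H : Subgroup N, H.Normal ∧ H ≠ ⊥ ∧ H ≠ ⊤ := by
    by_contra! hcon
    refine hns ?_
    have : Nontrivial N := (Subgroup.nontrivial_iff_ne_bot N).2 hbot
    exact ⟨fun H hH => or_iff_not_imp_left.2 (hcon H hH)⟩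
  obtain ⟨H, hHn, hH1, hH2⟩ := hH
  let Q : Subgroup G → Prop := fun T => T ≠ ⊥ ∧ ∀ n ∈ N, ∀ t ∈ T, n * t * n⁻¹ ∈ T
  have hQH : Q (H.map N.subtype) := by
    refine ⟨?_, ?_⟩
    · rwa [Ne, Subgroup.map_eq_bot_iff_of_injective _ N.subtype_injective]
    · rintro n hn _ ⟨t, ht, rfl⟩
      exact ⟨⟨n, hn⟩ * t * ⟨n, hn⟩⁻¹, hHn.conj_mem t ht ⟨n, hn⟩, rfl⟩
  obtain ⟨T, hTH, hT⟩ := exists_minimal_le_of_wellFoundedLT Q _ hQH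
  obtain ⟨hT1, hTn⟩ := hT.prop
  have hTN : T ≤ N := hTH.trans (Subgroup.map_subtype_le H)
  have hTneN : T ≠ N := by
    rintro rfl
    apply hH2
    rw [eq_top_iff]
    intro x _
    obtain ⟨y, hy, hyx⟩ := hTH x.2
    rwa [← Subtype.ext hyx]
  let C : Subgroup G := N ⊓ Subgroup.centralizer (T : Set G)
  have hCmem : ∀ c, c ∈ C ↔ c ∈ N ∧ ∀ t ∈ T, t * c = c * t := fun c => by
    simp only [C, Subgroup.mem_inf, Subgroup.mem_centralizer_iff, SetLike.mem_coe]
  have hcomm : ∀ t ∈ T, ∀ c ∈ C, t * c = c * t := fun t ht c hc => ((hCmem c).1 hc).2 t ht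
  have hCn : ∀ n ∈ N, ∀ c ∈ C, n * c * n⁻¹ ∈ C := by
    intro n hn c hc
    rw [hCmem]
    refine ⟨hnorm.conj_mem c ((hCmem c).1 hc).1 n, fun t ht => ?_⟩
    have h := hcomm _ (hTn n⁻¹ (inv_mem hn) t ht) c hc
    calc t * (n * c * n⁻¹) = n * ((n⁻¹ * t * n⁻¹⁻¹) * c) * n⁻¹ := by group
      _ = n * (c * (n⁻¹ * t * n⁻¹⁻¹)) * n⁻¹ := by rw [h]
      _ = n * c * n⁻¹ * t := by group
  have hconj : ∀ g : G, ∀ t ∈ T, g * t * g⁻¹ ∈ T ∨ g * t * g⁻¹ ∈ C := by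
    intro g
    let T' : Subgroup G := T.map (MulAut.conj g).toMonoidHom
    have hT' : ∀ t ∈ T, g * t * g⁻¹ ∈ T' := fun t ht => ⟨t, ht, rfl⟩
    have hT'N : T' ≤ N := by
      rintro _ ⟨t, ht, rfl⟩
      exact hnorm.conj_mem t (hTN ht) g
    have hT'n : ∀ n ∈ N, ∀ t ∈ T', n * t * n⁻¹ ∈ T' := by
      rintro n hn _ ⟨t, ht, rfl⟩
      have h1 : g⁻¹ * n * g ∈ N := by simpa using hnorm.conj_mem n hn g⁻¹
      have h2 := hT' _ (hTn _ h1 t ht)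
      convert h2 using 1
      simp only [MulEquiv.coe_toMonoidHom, MulAut.conj_apply]
      group
    by_cases hI : T ⊓ T' = ⊥
    · intro t ht
      right
      rw [hCmem]
      refine ⟨hT'N (hT' t ht), fun s hs => ?_⟩
      have h3 := hT' t ht
      set u := g * t * g⁻¹
      have h4 : s * u * s⁻¹ * u⁻¹ ∈ T ⊓ T' := by
        refine ⟨?_, T'.mul_mem (hT'n s (hTN hs) u h3) (T'.inv_mem h3)⟩
        have := mul_mem hs (hTn u (hT'N h3) _ (inv_mem hs))
        simpa [mul_assoc] using this
      rw [hI, Subgroup.mem_bot, mul_inv_eq_one, mul_inv_eq_iff_eq_mul] at h4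
      exact h4
    · have hle : T ≤ T ⊓ T' := hT.le_of_le
        ⟨hI, fun n hn t ht => ⟨hTn n hn t ht.1, hT'n n hn t ht.2⟩⟩ inf_le_left
      have hTT' : T = T' := by
        apply Subgroup.eq_of_le_of_card_ge (hle.trans inf_le_right)
        exact (Nat.card_congr
          (T.equivMapOfInjective _ (MulAut.conj g).injective).toEquiv).ge
      intro t ht
      left
      rw [hTT']
      exact hT' t ht
  have hprod : ∀ n ∈ N, ∃ t ∈ T, ∃ c ∈ C, n = t * c := by
    let K : Subgroup G :=
      { carrier := {n | ∃ t ∈ T, ∃ c ∈ C, n = t * c}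
        one_mem' := ⟨1, one_mem T, 1, one_mem C, by simp⟩
        mul_mem' := by
          rintro _ _ ⟨t, ht, c, hc, rfl⟩ ⟨s, hs, d, hd, rfl⟩
          refine ⟨t * s, mul_mem ht hs, c * d, mul_mem hc hd, ?_⟩
          have := hcomm s hs c hc
          calc t * c * (s * d) = t * (c * s) * d := by group
            _ = t * s * (c * d) := by rw [← this]; group
        inv_mem' := by
          rintro _ ⟨t, ht, c, hc, rfl⟩
          refine ⟨t⁻¹, T.inv_mem ht, c⁻¹, C.inv_mem hc, ?_⟩
          rw [hcomm t ht c hc, mul_inv_rev] }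
    have h1 : Subgroup.normalClosure (T : Set G) = N := by
      refine hmin _ inferInstance ?_ (Subgroup.normalClosure_le_normal hTN)
      intro h
      have h' : T ≤ Subgroup.normalClosure (T : Set G) := Subgroup.subset_normalClosure
      exact hT1 (le_bot_iff.1 (h ▸ h'))
    have h2 : Subgroup.normalClosure (T : Set G) ≤ K := by
      rw [Subgroup.normalClosure, Subgroup.closure_le]
      intro x hx
      obtain ⟨t, ht, g, rfl⟩ := by
        simpa only [Group.mem_conjugatesOfSet_iff, isConj_iff] using hx
      rcases hconj g t ht with h | h
      · exact ⟨_, h, 1, one_mem C, by simp⟩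
      · exact ⟨1, one_mem T, _, h, by simp⟩
    intro n hn
    exact h2 (h1 ▸ hn)
  refine ⟨T, C, hT1, ?_, hTN, inf_le_left, hTn, hCn, hcomm, hprod, ?_, hconj⟩
  · intro hC
    refine hTneN (le_antisymm hTN fun n hn => ?_)
    obtain ⟨t, ht, c, hc, rfl⟩ := hprod n hn
    rw [hC, Subgroup.mem_bot] at hc
    simpa [hc] using ht
  · intro t ht hct
    by_contra ht1
    have hle : T ≤ T ⊓ C := by
      refine hT.le_of_le ⟨?_, fun n hn t ht => ⟨hTn n hn t ht.1, hCn n hn t ht.2⟩⟩ inf_le_left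
      intro h
      have : t ∈ T ⊓ C := ⟨ht, (hCmem t).2 ⟨hTN ht, hct⟩⟩
      rw [h] at this
      exact ht1 this
    have hTZ : T ≤ N ⊓ Subgroup.centralizer (N : Set G) := by
      refine le_inf hTN fun s hs => Subgroup.mem_centralizer_iff.2 fun n hn => ?_
      obtain ⟨u, hu, c, hc, rfl⟩ := hprod n hn
      rw [mul_assoc, ← hcomm s hs c hc, ← mul_assoc, hcomm u hu s (hle hs).2, mul_assoc]
    have hZ : N ⊓ Subgroup.centralizer (N : Set G) = N :=
      hmin _ inferInstance (fun h => hT1 (le_bot_iff.1 (h ▸ hTZ))) inf_le_left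
    refine hna fun x hx y hy => ?_
    rw [← hZ] at hy
    exact Subgroup.mem_centralizer_iff.1 hy.2 x hx

variable {X : Type*} [MulAction G X]

open scoped Pointwise

/-- `B` is a block for the action of the subgroup `N`. -/
def Subgroup.HasBlock (N : Subgroup G) (B : Set X) : Prop :=
  ∀ n ∈ N, ∀ x ∈ B, n • x ∈ B → n • B = B

theorem Subgroup.HasBlock.inter {N : Subgroup G} {B D : Set X} (hB : N.HasBlock B)
    (hD : N.HasBlock D) : N.HasBlock (B ∩ D) := fun n hn x hx hnx => by
  rw [Set.smul_set_inter, hB n hn x hx.1 hnx.1, hD n hn x hx.2 hnx.2]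

theorem Subgroup.HasBlock.smul {N : Subgroup G} [hN : N.Normal] {B : Set X} (hB : N.HasBlock B)
    (g : G) : N.HasBlock (g • B) := by
  rintro n hn _ ⟨x, hx, rfl⟩ hnx
  have h1 : g⁻¹ * n * g ∈ N := by simpa using hN.conj_mem n hn g⁻¹
  have h2 := hB _ h1 x hx (by
    rw [Set.mem_smul_set_iff_inv_smul_mem] at hnx
    simpa [mul_smul] using hnx)
  have h3 : n • g • B = g • (g⁻¹ * n * g) • B := by simp [smul_smul, mul_assoc]
  rw [h3, h2]

/-- If a normal subgroup `N` of a `2`-transitive group is imprimitive, then two-point stabilisers in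
`N` are trivial. -/
theorem Subgroup.HasBlock.smul_eq_of_two_fixed [Finite X] {N : Subgroup G} [N.Normal]
    (h2 : ∀ a b c d : X, a ≠ b → c ≠ d → ∃ g : G, g • a = c ∧ g • b = d)
    {B₀ : Set X} (hB₀ : N.HasBlock B₀) (hB₀' : B₀.Nontrivial) (hB₀'' : B₀ ≠ Set.univ)
    {n : G} (hn : n ∈ N) {a b : X} (hab : a ≠ b) (ha : n • a = a) (hb : n • b = b) (x : X) :
    n • x = x := by
  obtain ⟨B, hBle, hB⟩ := exists_minimal_le_of_wellFoundedLT
    (fun B : Set X => N.HasBlock B ∧ B.Nontrivial) B₀ ⟨hB₀, hB₀'⟩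
  have hBu : B ≠ Set.univ := by
    rintro rfl
    exact hB₀'' (Set.univ_subset_iff.1 hBle)
  obtain ⟨hBb, hBn⟩ := hB.prop
  have hmin : ∀ D, N.HasBlock D → D.Nontrivial → D ⊆ B → B ⊆ D := fun D h1 h2 h3 =>
    hB.le_of_le ⟨h1, h2⟩ h3
  have hline : ∀ x y : X, x ≠ y → ∃ g : G, x ∈ g • B ∧ y ∈ g • B := by
    intro x y hxy
    obtain ⟨u, hu, v, hv, huv⟩ := hBn
    obtain ⟨g, rfl, rfl⟩ := h2 u v x y huv hxy
    exact ⟨g, Set.smul_mem_smul_set hu, Set.smul_mem_smul_set hv⟩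
  have hsub : ∀ (g h : G) (x y : X), x ≠ y → x ∈ g • B → y ∈ g • B → x ∈ h • B → y ∈ h • B →
      g • B ⊆ h • B := by
    intro g h x y hxy hxg hyg hxh hyh
    have h1 : N.HasBlock (g⁻¹ • (g • B ∩ h • B)) := ((hBb.smul g).inter (hBb.smul h)).smul g⁻¹
    have h3 := hmin _ h1 ⟨g⁻¹ • x, Set.smul_mem_smul_set ⟨hxg, hxh⟩, g⁻¹ • y,
      Set.smul_mem_smul_set ⟨hyg, hyh⟩, fun h => hxy (MulAction.injective _ h)⟩ (by
        rw [← Set.subset_smul_set_iff]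
        exact Set.inter_subset_left)
    rw [← Set.smul_set_subset_iff_subset_inv_smul_set] at h3
    exact h3.trans Set.inter_subset_right
  have hoff : ∀ (g : G) (a b x : X), a ≠ b → n • a = a → n • b = b → a ∈ g • B → b ∈ g • B →
      x ∉ g • B → n • x = x := by
    intro g a b x hab ha hb hag hbg hx
    have hax : a ≠ x := by rintro rfl; exact hx hag
    have hbx : b ≠ x := by rintro rfl; exact hx hbg
    obtain ⟨k, hak, hxk⟩ := hline a x hax
    obtain ⟨l, hbl, hxl⟩ := hline b x hbx
    by_contra hne
    have hk : n • x ∈ k • B := by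
      rw [← hBb.smul k n hn a hak (by rwa [ha])]
      exact Set.smul_mem_smul_set hxk
    have hl : n • x ∈ l • B := by
      rw [← hBb.smul l n hn b hbl (by rwa [hb])]
      exact Set.smul_mem_smul_set hxl
    have hlk := hsub l k _ _ hne hl hxl hk hxk
    exact hx (hsub k g a b hab hak (hlk hbl) hag hbg hxk)
  obtain ⟨g, hag, hbg⟩ := hline a b hab
  by_cases hx : x ∈ g • B
  · obtain ⟨d, hd⟩ : ∃ d, d ∉ g • B := by
      by_contra! hall
      refine hBu (Set.eq_univ_of_forall fun y => ?_)
      have := hall (g • y)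
      rwa [Set.smul_mem_smul_set_iff] at this
    have hnd := hoff g a b d hab ha hb hag hbg hd
    have had : a ≠ d := by rintro rfl; exact hd hag
    obtain ⟨k, hak, hdk⟩ := hline a d had
    rcases eq_or_ne x a with rfl | hxa
    · exact ha
    · refine hoff k a d x had ha hnd hak hdk fun hxk => hd ?_
      exact hsub k g x a hxa hxk hak hx hag hdk
  · exact hoff g a b x hab ha hb hag hbg hx

/-- If `N` is transitive with trivial two-point stabilisers and is the product of two commuting
nontrivial subgroups, then point stabilisers in `N` are trivial. -/
theorem Subgroup.eq_one_of_fixed_of_factors [FaithfulSMul G X] {N T C : Subgroup G}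
    (hX : Nontrivial X) (htr : ∀ a b : X, ∃ n ∈ N, n • a = b)
    (hN2 : ∀ n ∈ N, ∀ a b : X, a ≠ b → n • a = a → n • b = b → n = 1)
    (hT : T ≠ ⊥) (hC : C ≠ ⊥) (hTN : T ≤ N) (hCN : C ≤ N)
    (hcomm : ∀ t ∈ T, ∀ c ∈ C, t * c = c * t) (hprod : ∀ n ∈ N, ∃ t ∈ T, ∃ c ∈ C, n = t * c)
    {x : G} (hx : x ∈ N) {a : X} (hxa : x • a = a) : x = 1 := by
  have hcent : ∀ x ∈ N, x ≠ 1 → x • a = a → ∀ y : G, x * y = y * x → y • a = a := by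
    intro x hx hx1 hxa y hxy
    by_contra hy
    refine hx1 (hN2 x hx _ _ hy ?_ hxa)
    rw [smul_smul, hxy, mul_smul, hxa]
  have key : ∀ T C : Subgroup G, C ≠ ⊥ → T ≤ N → C ≤ N →
      (∀ t ∈ T, ∀ c ∈ C, t * c = c * t) → (∀ n ∈ N, ∃ t ∈ T, ∃ c ∈ C, n = t * c) →
      ∀ t ∈ T, t ≠ 1 → t • a ≠ a := by
    intro T C hC hTN hCN hcomm hprod t ht ht1 hta
    have hCa : ∀ c ∈ C, c • a = a := fun c hc => hcent t (hTN ht) ht1 hta c (hcomm t ht c hc)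
    obtain ⟨c, hc, hc1⟩ := C.bot_or_exists_ne_one.resolve_left hC
    have hTa : ∀ s ∈ T, s • a = a := fun s hs =>
      hcent c (hCN hc) hc1 (hCa c hc) s (hcomm s hs c hc).symm
    obtain ⟨b, hb⟩ := exists_ne a
    obtain ⟨n, hn, rfl⟩ := htr a b
    obtain ⟨s, hs, d, hd, rfl⟩ := hprod n hn
    exact hb (by rw [mul_smul, hCa d hd, hTa s hs])
  by_contra hx1
  obtain ⟨t, ht, c, hc, rfl⟩ := hprod x hx
  have hta : t • a = a := hcent _ hx hx1 hxa t (by rw [mul_assoc, ← hcomm t ht c hc])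
  have hca : c • a = a := by rwa [mul_smul, ← eq_inv_smul_iff, inv_smul_eq_iff.2 hta.symm] at hxa
  have ht1 : t = 1 := by
    by_contra h
    exact key T C hC hTN hCN hcomm hprod t ht h hta
  have hc1 : c = 1 := by
    by_contra h
    refine key C T hT hCN hTN (fun c hc t ht => (hcomm t ht c hc).symm) (fun n hn => ?_) c hc h hca
    obtain ⟨t, ht, c, hc, rfl⟩ := hprod n hn
    exact ⟨c, hc, t, ht, hcomm t ht c hc⟩
  exact hx1 (by rw [ht1, hc1, mul_one])

/-- A nontrivial subgroup normalised by a transitive group without nontrivial blocks is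
transitive. -/
theorem Subgroup.exists_smul_eq_of_no_blocks [FaithfulSMul G X] {N K : Subgroup G}
    (htr : ∀ a b : X, ∃ n ∈ N, n • a = b)
    (hprim : ∀ B : Set X, N.HasBlock B → B.Nontrivial → B = Set.univ)
    (hK : K ≠ ⊥) (hKn : ∀ n ∈ N, ∀ k ∈ K, n * k * n⁻¹ ∈ K) (a b : X) : ∃ k ∈ K, k • a = b := by
  have hblock : N.HasBlock (MulAction.orbit K a) := by
    have aux : ∀ n ∈ N, ∀ x ∈ MulAction.orbit K a, n • x ∈ MulAction.orbit K a →
        n • MulAction.orbit K a ⊆ MulAction.orbit K a := by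
      rintro n hn _ ⟨k, rfl⟩ ⟨l, hl⟩ _ ⟨_, ⟨m, rfl⟩, rfl⟩
      refine ⟨⟨_, hKn n hn _ (m * k⁻¹).2⟩ * l, ?_⟩
      change (l : G) • a = n • (k : G) • a at hl
      change ((n * ((m : G) * (k : G)⁻¹) * n⁻¹) * (l : G)) • a = n • (m : G) • a
      rw [mul_smul, hl]
      simp [mul_smul]
    intro n hn x hx hnx
    refine (aux n hn x hx hnx).antisymm ?_
    rw [Set.subset_smul_set_iff]
    exact aux n⁻¹ (inv_mem hn) (n • x) hnx (by rwa [inv_smul_smul])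
  by_cases hnt : (MulAction.orbit K a).Nontrivial
  · have := hprim _ hblock hnt
    obtain ⟨k, hk⟩ : b ∈ MulAction.orbit K a := this ▸ Set.mem_univ b
    exact ⟨k, k.2, hk⟩
  · exfalso
    rw [Set.not_nontrivial_iff] at hnt
    have hfix : ∀ k ∈ K, k • a = a := fun k hk =>
      hnt (⟨⟨k, hk⟩, rfl⟩ : k • a ∈ MulAction.orbit K a) (MulAction.mem_orbit_self a)
    refine hK ((Subgroup.eq_bot_iff_forall _).2 fun k hk => ?_)
    refine FaithfulSMul.eq_of_smul_eq_smul (α := X) fun x => ?_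
    obtain ⟨n, hn, rfl⟩ := htr a x
    have := hfix _ (hKn n⁻¹ (inv_mem hn) k hk)
    rw [inv_inv, mul_smul, mul_smul, inv_smul_eq_iff] at this
    rw [this, one_smul]

/-- **Burnside's theorem**: a nonabelian, nonregular, transitive minimal normal subgroup of a finite
`2`-transitive group is simple. -/
theorem IsMinimalNormal.isSimpleGroup_of_two_transitive [Finite G] [Finite X] [FaithfulSMul G X]
    (h2 : ∀ a b c d : X, a ≠ b → c ≠ d → ∃ g : G, g • a = c ∧ g • b = d)
    {N : Subgroup G} (hN : IsMinimalNormal N) (hna : ¬ ∀ x ∈ N, ∀ y ∈ N, x * y = y * x)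
    (htr : ∀ a b : X, ∃ n ∈ N, n • a = b) {n : G} (hn : n ∈ N) (hn1 : n ≠ 1) {a : X}
    (hna' : n • a = a) : IsSimpleGroup N := by
  refine (hN.isSimpleGroup_or_exists_factors hna).resolve_right ?_
  rintro ⟨T, C, hT, hC, hTN, hCN, hTn, hCn, hcomm, hprod, hZ, hconj⟩
  have := hN.1
  have hX : Nontrivial X := by
    by_contra h
    rw [not_nontrivial_iff_subsingleton] at h
    exact hn1 (FaithfulSMul.eq_of_smul_eq_smul (α := X) fun x => Subsingleton.elim _ _)
  by_cases hprim : ∀ B : Set X, N.HasBlock B → B.Nontrivial → B = Set.univ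
  · have hTtr := Subgroup.exists_smul_eq_of_no_blocks htr hprim hT hTn
    have hCtr := Subgroup.exists_smul_eq_of_no_blocks htr hprim hC hCn
    have hTreg : ∀ t ∈ T, t • a = a → t = 1 := fun t ht hta =>
      FaithfulSMul.eq_of_smul_eq_smul (α := X) fun x => by
        obtain ⟨c, hc, rfl⟩ := hCtr a x
        rw [smul_smul, hcomm t ht c hc, mul_smul, hta, one_smul]
    have hCreg : ∀ c ∈ C, c • a = a → c = 1 := fun c hc hca =>
      FaithfulSMul.eq_of_smul_eq_smul (α := X) fun x => by
        obtain ⟨t, ht, rfl⟩ := hTtr a x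
        rw [smul_smul, ← hcomm t ht c hc, mul_smul, hca, one_smul]
    have hord : ∀ s ∈ T, ∀ t ∈ T, s ≠ 1 → t ≠ 1 → orderOf s = orderOf t := by
      intro s hs t ht hs1 ht1
      obtain ⟨g, hga, hgt⟩ := h2 a (t • a) a (s • a) (fun h => ht1 (hTreg t ht h.symm))
        (fun h => hs1 (hTreg s hs h.symm))
      have hga' : g⁻¹ • a = a := inv_smul_eq_iff.2 hga.symm
      have hu : (s⁻¹ * (g * t * g⁻¹)) • a = a := by
        rw [mul_smul, mul_smul, mul_smul, hga', hgt, inv_smul_smul]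
      have hordt : orderOf (g * t * g⁻¹) = orderOf t := by
        simpa using MulEquiv.orderOf_eq (MulAut.conj g) t
      rw [← hordt]
      rcases hconj g t ht with h | h
      · rw [← inv_mul_eq_one.1 (hTreg _ (mul_mem (inv_mem hs) h) hu)]
      · set c := g * t * g⁻¹
        have hsc : Commute s⁻¹ c := hcomm _ (inv_mem hs) c h
        refine orderOf_eq_orderOf_iff.2 fun m => ?_
        have hm : (s⁻¹ * c) ^ m • a = a := by
          induction m with
          | zero => simp
          | succ m ih => rw [pow_succ, mul_smul, hu, ih]
        rw [hsc.mul_pow] at hm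
        constructor
        · intro hsm
          rw [inv_pow, hsm, inv_one, one_mul] at hm
          exact hCreg _ (pow_mem h m) hm
        · intro hcm
          rw [hcm, mul_one] at hm
          simpa using hTreg _ (pow_mem (inv_mem hs) m) hm
    have hTnt : Nontrivial T := (Subgroup.nontrivial_iff_ne_bot T).2 hT
    obtain ⟨p, hp, hpd⟩ := Nat.exists_prime_and_dvd (Finite.one_lt_card (α := T)).ne'
    have := Fact.mk hp
    obtain ⟨s, hs⟩ := exists_prime_orderOf_dvd_card' p hpd
    have hs1 : (s : G) ≠ 1 := by
      intro h
      rw [OneMemClass.coe_eq_one.1 h, orderOf_one] at hs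
      exact hp.one_lt.ne hs
    have hpT : IsPGroup p T := fun t => ⟨1, by
      by_cases ht : (t : G) = 1
      · rw [OneMemClass.coe_eq_one.1 ht, one_pow]
      · have := hord t t.2 s s.2 ht hs1
        rw [Subgroup.orderOf_coe, Subgroup.orderOf_coe, hs] at this
        rw [pow_one, ← this, pow_orderOf_eq_one]⟩
    have := hpT.center_nontrivial
    obtain ⟨z, hz⟩ := exists_ne (1 : Subgroup.center T)
    refine hz (Subtype.ext (Subtype.ext (hZ _ z.1.2 fun u hu => ?_)))
    exact congrArg Subtype.val (Subgroup.mem_center_iff.1 z.2 ⟨u, hu⟩)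
  · push Not at hprim
    obtain ⟨B, hB, hB', hB''⟩ := hprim
    refine hn1 (Subgroup.eq_one_of_fixed_of_factors hX htr (fun n hn a b hab ha hb => ?_)
      hT hC hTN hCN hcomm hprod hn hna')
    refine FaithfulSMul.eq_of_smul_eq_smul (α := X) fun x => ?_
    rw [one_smul]
    exact hB.smul_eq_of_two_fixed h2 hB' hB'' hn hab ha hb x

end Burnside

section BlockSystem

variable {Ω : Type*} {G : Subgroup (Equiv.Perm Ω)} {P Q : Set (Set Ω)}

/-- Two points are related if they lie in a common part of `P`. -/
def SamePart (P : Set (Set Ω)) (x y : Ω) : Prop := ∃ S ∈ P, x ∈ S ∧ y ∈ S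

namespace IsBlockSystem

theorem eq_of_mem (hP : IsBlockSystem G P) {S T : Set Ω} (hS : S ∈ P) (hT : T ∈ P) {x : Ω}
    (hxS : x ∈ S) (hxT : x ∈ T) : S = T :=
  (hP.1.2 x).unique ⟨hS, hxS⟩ ⟨hT, hxT⟩

theorem exists_mem (hP : IsBlockSystem G P) (x : Ω) : ∃ S ∈ P, x ∈ S :=
  (hP.1.2 x).exists

theorem nonempty (hP : IsBlockSystem G P) {S : Set Ω} (hS : S ∈ P) : S.Nonempty :=
  Set.nonempty_iff_ne_empty.2 fun h => hP.1.1 (h ▸ hS)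

theorem samePart_refl (hP : IsBlockSystem G P) (x : Ω) : SamePart P x x :=
  let ⟨S, hS, hx⟩ := hP.exists_mem x
  ⟨S, hS, hx, hx⟩

theorem samePart_symm {x y : Ω} : SamePart P x y → SamePart P y x :=
  fun ⟨S, hS, hx, hy⟩ => ⟨S, hS, hy, hx⟩

theorem samePart_trans (hP : IsBlockSystem G P) {x y z : Ω} :
    SamePart P x y → SamePart P y z → SamePart P x z := by
  rintro ⟨S, hS, hx, hy⟩ ⟨T, hT, hy', hz⟩
  obtain rfl := hP.eq_of_mem hS hT hy hy'
  exact ⟨S, hS, hx, hz⟩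

theorem mem_iff_samePart (hP : IsBlockSystem G P) {S : Set Ω} (hS : S ∈ P) {x : Ω} (hx : x ∈ S)
    (y : Ω) : y ∈ S ↔ SamePart P x y := by
  refine ⟨fun hy => ⟨S, hS, hx, hy⟩, ?_⟩
  rintro ⟨T, hT, hxT, hy⟩
  rwa [hP.eq_of_mem hS hT hx hxT]

theorem samePart_apply (hP : IsBlockSystem G P) {g : Equiv.Perm Ω} (hg : g ∈ G) (x y : Ω) :
    SamePart P (g x) (g y) ↔ SamePart P x y := by
  constructor
  · rintro ⟨S, hS, hx, hy⟩
    exact ⟨_, hP.2 g⁻¹ (inv_mem hg) S hS, ⟨_, hx, by simp⟩, ⟨_, hy, by simp⟩⟩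
  · rintro ⟨S, hS, hx, hy⟩
    exact ⟨_, hP.2 g hg S hS, ⟨_, hx, rfl⟩, ⟨_, hy, rfl⟩⟩

theorem subset_of_samePart_iff (hP : IsBlockSystem G P) (hQ : IsBlockSystem G Q)
    (h : ∀ x y, SamePart P x y ↔ SamePart Q x y) : P ⊆ Q := by
  intro S hS
  obtain ⟨x, hx⟩ := hP.nonempty hS
  obtain ⟨T, hT, hxT⟩ := hQ.exists_mem x
  have : S = T := by
    ext y
    rw [hP.mem_iff_samePart hS hx, hQ.mem_iff_samePart hT hxT, h]
  rwa [this]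

theorem exists_samePart_ne (hP : IsBlockSystem G P) (hP' : IsNontrivialSystem P)
    (htrans : ∀ p q : Ω, ∃ g ∈ G, g p = q) (x : Ω) : ∃ y, x ≠ y ∧ SamePart P x y := by
  obtain ⟨S, hS, hS'⟩ := hP'.1
  rw [Set.not_subsingleton_iff] at hS'
  obtain ⟨a, ha, b, hb, hab⟩ := hS'
  obtain ⟨g, hg, rfl⟩ := htrans a x
  exact ⟨g b, g.injective.ne hab, (hP.samePart_apply hg a b).2 ⟨S, hS, ha, hb⟩⟩

theorem ne_univ (hP : IsBlockSystem G P) (hP' : IsNontrivialSystem P) {S : Set Ω} (hS : S ∈ P) :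
    S ≠ Set.univ := by
  rintro rfl
  obtain ⟨T, hT, hT'⟩ := hP'.2
  obtain ⟨x, hx⟩ := hP.nonempty hT
  exact hT' (hP.eq_of_mem hT hS hx (Set.mem_univ x))

theorem exists_not_samePart (hP : IsBlockSystem G P) (hP' : IsNontrivialSystem P) (x : Ω) :
    ∃ y, ¬ SamePart P x y := by
  obtain ⟨S, hS, hx⟩ := hP.exists_mem x
  obtain ⟨y, hy⟩ := (Set.ne_univ_iff_exists_notMem S).1 (hP.ne_univ hP' hS)
  exact ⟨y, fun h => hy ((hP.mem_iff_samePart hS hx y).2 h)⟩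

/-- The action of `G` on the parts of a block system. -/
abbrev mulAction (hP : IsBlockSystem G P) : MulAction G P where
  smul g S := ⟨(g : Equiv.Perm Ω) '' S, hP.2 g g.2 S S.2⟩
  one_smul _ := Subtype.ext (Set.image_id _)
  mul_smul g h _ := Subtype.ext (Set.image_comp (g : Equiv.Perm Ω) (h : Equiv.Perm Ω) _)

open Classical in
/-- In rank `3`, the orbitals are the diagonal, the pairs of distinct points in a common part, and
the pairs of points in different parts. -/
theorem exists_apply_eq_of_rank_three (hP : IsBlockSystem G P) (hP' : IsNontrivialSystem P)
    (htrans : ∀ p q : Ω, ∃ g ∈ G, g p = q)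
    (hrank : Nat.card (MulAction.orbitRel.Quotient G (Ω × Ω)) = 3) {x y z w : Ω}
    (hxy : x ≠ y) (hzw : z ≠ w) (h : SamePart P x y ↔ SamePart P z w) :
    ∃ g ∈ G, g x = z ∧ g y = w := by
  let f : Ω × Ω → Fin 3 := fun q => if q.1 = q.2 then 0 else if SamePart P q.1 q.2 then 1 else 2
  have hf : ∀ q r : Ω × Ω, MulAction.orbitRel G (Ω × Ω) q r → f q = f r := by
    rintro _ r ⟨g, rfl⟩
    have h1 := hP.samePart_apply g.2 r.1 r.2
    have h2 := (g : Equiv.Perm Ω).injective.eq_iff (a := r.1) (b := r.2)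
    change (if (g : Equiv.Perm Ω) r.1 = (g : Equiv.Perm Ω) r.2 then (0 : Fin 3) else
      if SamePart P ((g : Equiv.Perm Ω) r.1) ((g : Equiv.Perm Ω) r.2) then 1 else 2) = f r
    simp only [h1, h2, f]
  let F : MulAction.orbitRel.Quotient G (Ω × Ω) → Fin 3 := Quotient.lift f hf
  obtain ⟨b, hb, hxb⟩ := hP.exists_samePart_ne hP' htrans x
  obtain ⟨c, hc⟩ := hP.exists_not_samePart hP' x
  have hxc : x ≠ c := by
    rintro rfl
    exact hc (hP.samePart_refl x)
  have hsurj : Function.Surjective F := by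
    intro i
    fin_cases i
    · exact ⟨Quotient.mk _ (x, x), by simp [F, f]⟩
    · exact ⟨Quotient.mk _ (x, b), by simp [F, f, hb, hxb]⟩
    · exact ⟨Quotient.mk _ (x, c), by simp [F, f, hxc, hc]⟩
  have hfin : Finite (MulAction.orbitRel.Quotient G (Ω × Ω)) :=
    Nat.finite_of_card_ne_zero (by rw [hrank]; norm_num)
  have hinj : Function.Injective F :=
    ((Nat.bijective_iff_surjective_and_card F).2 ⟨hsurj, by simp [hrank]⟩).1
  have hq : F (Quotient.mk _ (z, w)) = F (Quotient.mk _ (x, y)) := by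
    simp [F, f, hxy, hzw, h]
  obtain ⟨g, hg⟩ := Quotient.exact (hinj hq)
  exact ⟨g, g.2, congrArg Prod.fst hg, congrArg Prod.snd hg⟩

theorem eq_of_rank_three [Nonempty Ω] (hP : IsBlockSystem G P) (hP' : IsNontrivialSystem P)
    (hQ : IsBlockSystem G Q) (hQ' : IsNontrivialSystem Q)
    (htrans : ∀ p q : Ω, ∃ g ∈ G, g p = q)
    (hrank : Nat.card (MulAction.orbitRel.Quotient G (Ω × Ω)) = 3) : Q = P := by
  obtain ⟨a⟩ := ‹Nonempty Ω›
  obtain ⟨b, hab, hPab⟩ := hP.exists_samePart_ne hP' htrans a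
  obtain ⟨c, hPac⟩ := hP.exists_not_samePart hP' a
  have hac : a ≠ c := by
    rintro rfl
    exact hPac (hP.samePart_refl a)
  have key : ∀ x y z w, x ≠ y → z ≠ w → (SamePart P x y ↔ SamePart P z w) →
      (SamePart Q x y ↔ SamePart Q z w) := by
    intro x y z w hxy hzw h
    obtain ⟨g, hg, rfl, rfl⟩ := hP.exists_apply_eq_of_rank_three hP' htrans hrank hxy hzw h
    exact (hQ.samePart_apply hg x y).symm
  have hPQ : ∀ x y, x ≠ y → (SamePart Q x y ↔
      (SamePart P x y ∧ SamePart Q a b) ∨ (¬ SamePart P x y ∧ SamePart Q a c)) := by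
    intro x y hxy
    by_cases h : SamePart P x y
    · simp [h, key x y a b hxy hab (by simp [h, hPab])]
    · simp [h, key x y a c hxy hac (by simp [h, hPac])]
  obtain ⟨d, had, hQad⟩ := hQ.exists_samePart_ne hQ' htrans a
  obtain ⟨e, hQae⟩ := hQ.exists_not_samePart hQ' a
  have hae : a ≠ e := by
    rintro rfl
    exact hQae (hQ.samePart_refl a)
  have hPbc : ¬ SamePart P b c := fun h => hPac (hP.samePart_trans hPab h)
  have hbc : b ≠ c := by
    rintro rfl
    exact hPac hPab
  have hsymm : SamePart Q a c → SamePart Q b c → SamePart Q a b := fun h1 h2 =>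
    hQ.samePart_trans h1 (samePart_symm h2)
  have hd := (hPQ a d had).1 hQad
  have he := (hPQ a e hae).not.1 hQae
  have hbc' := hPQ b c hbc
  have hiff : SamePart Q a b ∧ ¬ SamePart Q a c := by tauto
  have hfinal : ∀ x y, SamePart P x y ↔ SamePart Q x y := by
    intro x y
    rcases eq_or_ne x y with rfl | hxy
    · simp [hP.samePart_refl, hQ.samePart_refl]
    · simp [hPQ x y hxy, hiff]
  exact (hQ.subset_of_samePart_iff hP fun x y => (hfinal x y).symm).antisymm
    (hP.subset_of_samePart_iff hQ hfinal)

end IsBlockSystem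

end BlockSystem

/-- let `G` be a quasiprimitive, transitive, imprimitive permutation
group of rank 3 on a finite set `Ω`. Then `G` is almost simple (it has a unique
minimal normal subgroup, which is nonabelian simple), and `G` acts faithfully and
2-transitively on its unique nontrivial system of imprimitivity. -/
theorem stmt_19 {Ω : Type*} [Fintype Ω] (G : Subgroup (Equiv.Perm Ω))
    (htrans : ∀ p q : Ω, ∃ g ∈ G, g p = q)
    (hrank3 : Nat.card (MulAction.orbitRel.Quotient G (Ω × Ω)) = 3)
    (himprim : ∃ P : Set (Set Ω), IsBlockSystem G P ∧ IsNontrivialSystem P)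
    (hqp : ∀ N : Subgroup G, N.Normal → N ≠ ⊥ →
      ∀ p q : Ω, ∃ x : G, x ∈ N ∧ (x : Equiv.Perm Ω) p = q) :
    (∃ N : Subgroup G, IsMinimalNormal N ∧ IsSimpleGroup N ∧
      (∃ x y : N, x * y ≠ y * x) ∧
      ∀ M : Subgroup G, IsMinimalNormal M → M = N) ∧
    ∃ P : Set (Set Ω), (IsBlockSystem G P ∧ IsNontrivialSystem P) ∧
      (∀ Q : Set (Set Ω), IsBlockSystem G Q ∧ IsNontrivialSystem Q → Q = P) ∧
      (∀ g ∈ G, (∀ S ∈ P, ⇑g '' S = S) → g = 1) ∧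
      (∀ S S' U U' : Set Ω, S ∈ P → S' ∈ P → U ∈ P → U' ∈ P → S ≠ S' → U ≠ U' →
        ∃ g ∈ G, ⇑g '' S = U ∧ ⇑g '' S' = U') := by
  obtain ⟨P, hP, hP'⟩ := himprim
  obtain ⟨S₀, hS₀, -⟩ := hP'.1
  obtain ⟨a, ha⟩ := hP.nonempty hS₀
  have hΩ : Nonempty Ω := ⟨a⟩
  obtain ⟨b, hab, hPab⟩ := hP.exists_samePart_ne hP' htrans a
  obtain ⟨c, hPac⟩ := hP.exists_not_samePart hP' a
  have hb : b ∈ S₀ := (hP.mem_iff_samePart hS₀ ha b).2 hPab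
  let _ := hP.mulAction
  have hsmul : ∀ (g : G) (S : P), ((g • S : P) : Set Ω) = (g : Equiv.Perm Ω) '' S :=
    fun _ _ => rfl
  have himage : ∀ (g : G) {S T : Set Ω}, S ∈ P → T ∈ P → ∀ x ∈ S, (g : Equiv.Perm Ω) x ∈ T →
      (g : Equiv.Perm Ω) '' S = T := fun g S T hS hT x hx hgx =>
    hP.eq_of_mem (hP.2 g g.2 S hS) hT ⟨x, hx, rfl⟩ hgx
  have htwo : ∀ S S' U U' : Set Ω, S ∈ P → S' ∈ P → U ∈ P → U' ∈ P → S ≠ S' → U ≠ U' →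
      ∃ g ∈ G, ⇑g '' S = U ∧ ⇑g '' S' = U' := by
    intro S S' U U' hS hS' hU hU' hSS' hUU'
    have hdiff : ∀ {S T : Set Ω}, S ∈ P → T ∈ P → S ≠ T → ∀ x ∈ S, ∀ y ∈ T,
        x ≠ y ∧ ¬ SamePart P x y := by
      intro S T hS hT hST x hx y hy
      have h : ¬ SamePart P x y := fun h =>
        hST (hP.eq_of_mem hS hT ((hP.mem_iff_samePart hS hx y).2 h) hy)
      exact ⟨fun hxy => h (hxy ▸ hP.samePart_refl x), h⟩
    obtain ⟨s, hs⟩ := hP.nonempty hS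
    obtain ⟨s', hs'⟩ := hP.nonempty hS'
    obtain ⟨u, hu⟩ := hP.nonempty hU
    obtain ⟨u', hu'⟩ := hP.nonempty hU'
    obtain ⟨h1, h2⟩ := hdiff hS hS' hSS' s hs s' hs'
    obtain ⟨h3, h4⟩ := hdiff hU hU' hUU' u hu u' hu'
    obtain ⟨g, hg, rfl, rfl⟩ := hP.exists_apply_eq_of_rank_three hP' htrans hrank3 h1 h3
      (iff_of_false h2 h4)
    exact ⟨g, hg, himage ⟨g, hg⟩ hS hU s hs hu, himage ⟨g, hg⟩ hS' hU' s' hs' hu'⟩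
  have hker : (MulAction.toPermHom G P).ker = ⊥ := by
    by_contra hne
    obtain ⟨g, hg, hgac⟩ := hqp _ inferInstance hne a c
    have h1 : g • (⟨S₀, hS₀⟩ : P) = ⟨S₀, hS₀⟩ := by
      rw [MonoidHom.mem_ker] at hg
      exact Equiv.congr_fun hg _
    have h2 : (g : Equiv.Perm Ω) '' S₀ = S₀ := congrArg Subtype.val h1
    refine hPac ⟨S₀, hS₀, ha, ?_⟩
    rw [← h2, ← hgac]
    exact ⟨a, ha, rfl⟩
  have hfaithful : FaithfulSMul G P := by
    refine ⟨fun {g h} hgh => ?_⟩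
    exact (MonoidHom.ker_eq_bot_iff _).1 hker (Equiv.ext hgh)
  have hfaith : ∀ g ∈ G, (∀ S ∈ P, ⇑g '' S = S) → g = 1 := by
    intro g hg h
    have : (⟨g, hg⟩ : G) = 1 := FaithfulSMul.eq_of_smul_eq_smul (α := P) fun S => by
      rw [one_smul]
      exact Subtype.ext (h S S.2)
    exact congrArg Subtype.val this
  have htr : ∀ N : Subgroup G, N.Normal → N ≠ ⊥ → ∀ S T : P, ∃ n ∈ N, n • S = T := by
    intro N hN hN1 S T
    obtain ⟨s, hs⟩ := hP.nonempty S.2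
    obtain ⟨t, ht⟩ := hP.nonempty T.2
    obtain ⟨n, hn, rfl⟩ := hqp N hN hN1 s t
    exact ⟨n, hn, Subtype.ext (himage n S.2 T.2 s hs ht)⟩
  have hfixed : ∀ N : Subgroup G, N.Normal → N ≠ ⊥ →
      ∃ n ∈ N, n ≠ 1 ∧ n • (⟨S₀, hS₀⟩ : P) = ⟨S₀, hS₀⟩ := by
    intro N hN hN1
    obtain ⟨n, hn, hnab⟩ := hqp N hN hN1 a b
    refine ⟨n, hn, ?_, Subtype.ext (himage n hS₀ hS₀ a ha (hnab ▸ hb))⟩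
    rintro rfl
    exact hab hnab
  have hcent : ∀ N M : Subgroup G, N.Normal → M.Normal → N ≠ ⊥ →
      (∀ n ∈ N, ∀ m ∈ M, n * m = m * n) → M = ⊥ := by
    intro N M hN hM hN1 hcomm
    by_contra hM1
    obtain ⟨n, hn, hn1, hnS⟩ := hfixed N hN hN1
    refine hn1 (FaithfulSMul.eq_of_smul_eq_smul (α := P) fun T => ?_)
    obtain ⟨m, hm, rfl⟩ := htr M hM hM1 ⟨S₀, hS₀⟩ T
    rw [smul_smul, hcomm n hn m hm, mul_smul, hnS, one_smul]
  have hGbot : (⊤ : Subgroup G) ≠ ⊥ := by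
    intro h
    obtain ⟨g, hg, hgab⟩ := htrans a b
    have h1 : (⟨g, hg⟩ : G) ∈ (⊤ : Subgroup G) := Subgroup.mem_top _
    rw [h, Subgroup.mem_bot] at h1
    obtain rfl : g = 1 := congrArg Subtype.val h1
    exact hab hgab
  obtain ⟨N, -, hNmin⟩ := exists_minimal_le_of_wellFoundedLT
    (fun N : Subgroup G => N.Normal ∧ N ≠ ⊥) ⊤ ⟨inferInstance, hGbot⟩
  have hN : IsMinimalNormal N := ⟨hNmin.prop.1, hNmin.prop.2, fun M hM hM1 hMN =>
    hMN.antisymm (hNmin.le_of_le ⟨hM, hM1⟩ hMN)⟩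
  have hna : ¬ ∀ x ∈ N, ∀ y ∈ N, x * y = y * x := fun h =>
    hN.2.1 (hcent N N hN.1 hN.1 hN.2.1 h)
  refine ⟨⟨N, hN, ?_, ?_, ?_⟩, P, ⟨hP, hP'⟩, fun Q hQ =>
    hP.eq_of_rank_three hP' hQ.1 hQ.2 htrans hrank3, hfaith, htwo⟩
  · obtain ⟨n, hn, hn1, hnS⟩ := hfixed N hN.1 hN.2.1
    refine hN.isSimpleGroup_of_two_transitive (X := P) ?_ hna (htr N hN.1 hN.2.1) hn hn1 hnS
    intro A B C D hAB hCD
    obtain ⟨g, hg, h1, h2⟩ := htwo A B C D A.2 B.2 C.2 D.2 (Subtype.coe_injective.ne hAB)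
      (Subtype.coe_injective.ne hCD)
    exact ⟨⟨g, hg⟩, Subtype.ext h1, Subtype.ext h2⟩
  · by_contra! h
    exact hna fun x hx y hy => congrArg Subtype.val (h ⟨x, hx⟩ ⟨y, hy⟩)
  · intro M hM
    have := hN.1
    have := hM.1
    by_cases hI : M ⊓ N = ⊥
    · refine absurd (hcent N M hN.1 hM.1 hN.2.1 fun n hn m hm => ?_) hM.2.1
      exact (Subgroup.commute_of_normal_of_disjoint M N hM.1 hN.1 (disjoint_iff.2 hI) m n hm hn).symm
    · rw [← hM.2.2 _ inferInstance hI inf_le_left, hN.2.2 _ inferInstance hI inf_le_right]
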